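/- Let (E,j) be a soft inductive system of Banach spaces over a directed set N and let φ_• be a uniformly bounded net of continuous linear functionals φ_n ∈ E_n'. Then φ_• is j*-convergent (i.e. lim_n ⟨x_n, φ_n⟩ exists for every j-convergent net x_•) if and only if for every m ∈ N the net (φ_n ∘ j_{nm})_{n ≥ m} converges in the weak* topology of E_m'. In that case, for every m the weak* limit of (φ_n ∘ j_{nm})_n equals φ_∞ ∘ j_{∞m}, where φ_∞ is the bounded linear functional on E_∞ defined by φ_∞(j-lim_n x_n) = lim_n ⟨x_n, φ_n⟩. -/

import Mathlib

open Filter Topology MeasureTheory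

variable {N : Type*} [Preorder N] [IsDirected N (· ≤ ·)] [Nonempty N]
variable {E : N → Type*} [∀ n, NormedAddCommGroup (E n)] [∀ n, NormedSpace ℂ (E n)]
  [∀ n, CompleteSpace (E n)]

/-- A *soft inductive system* of Banach spaces over the directed set `N`:
linear contractions `j n m : E m → E n` (for `n ≥ m`, with `j n n = id` and
`j n m = 0` when `¬ m ≤ n`), satisfying
`lim_m limsup_n ‖(j n l - j n m ∘ j m l) x‖ = 0` for all `l` and `x : E l`. -/
structure IsSoftInductiveSystem (j : ∀ n m : N, E m →L[ℂ] E n) : Prop where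
  map_self : ∀ n, j n n = ContinuousLinearMap.id ℂ (E n)
  map_not_le : ∀ n m, ¬ m ≤ n → j n m = 0
  contraction : ∀ n m, m ≤ n → ∀ x : E m, ‖j n m x‖ ≤ ‖x‖
  soft : ∀ (l : N) (x : E l),
    Tendsto (fun m => limsup (fun n => ‖j n l x - j n m (j m l x)‖) atTop)
      atTop (𝓝 0)

/-- A net `x = (x n)_{n ∈ N}` (with `x n ∈ E n`) is uniformly bounded. -/
def UniformlyBounded (x : ∀ n, E n) : Prop := ∃ C : ℝ, ∀ n, ‖x n‖ ≤ C

/-- The seminorm `|‖x‖| = limsup_n ‖x n‖` on uniformly bounded nets. -/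
noncomputable def netSeminorm (x : ∀ n, E n) : ℝ := limsup (fun n => ‖x n‖) atTop

/-- The basic net `j_{• m} ξ` associated with `ξ ∈ E m`. -/
def basicNet (j : ∀ n m : N, E m →L[ℂ] E n) (m : N) (ξ : E m) : ∀ n, E n :=
  fun n => j n m ξ

/-- A uniformly bounded net is `j`-convergent if it lies in the seminorm-closure of
the set of basic nets. -/
def JConvergent (j : ∀ n m : N, E m →L[ℂ] E n) (x : ∀ n, E n) : Prop :=
  UniformlyBounded x ∧
    ∀ ε : ℝ, 0 < ε → ∃ (m : N) (ξ : E m), netSeminorm (fun n => x n - j n m ξ) < ε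

/-- A net is a null net if `lim_n ‖x n‖ = 0`. -/
def IsNullNet (x : ∀ n, E n) : Prop := Tendsto (fun n => ‖x n‖) atTop (𝓝 0)

/-- A realization `(G, L)` of the limit space `E_∞ = C(E,j)/C₀(E,j)` of a soft inductive
system: `L` sends a `j`-convergent net to its `j`-limit; it is linear on `j`-convergent
nets, the norm of a `j`-limit is the seminorm of the net, and every element of `G`
arises as a `j`-limit. -/
structure IsLimitSpace (j : ∀ n m : N, E m →L[ℂ] E n) (G : Type*)
    [NormedAddCommGroup G] [NormedSpace ℂ G] (L : (∀ n, E n) → G) : Prop where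
  map_add : ∀ x y, JConvergent j x → JConvergent j y → L (x + y) = L x + L y
  map_smul : ∀ (c : ℂ) (x), JConvergent j x → L (c • x) = c • L x
  norm_eq : ∀ x, JConvergent j x → ‖L x‖ = netSeminorm x
  surjective : ∀ g : G, ∃ x, JConvergent j x ∧ L x = g

set_option linter.unusedSectionVars false

theorem UniformlyBounded.isBoundedUnder_norm {x : ∀ n, E n} (hx : UniformlyBounded x) :
    IsBoundedUnder (· ≤ ·) atTop (fun n => ‖x n‖) :=
  hx.elim fun _ hC => isBoundedUnder_of ⟨_, hC⟩

theorem UniformlyBounded.add {x y : ∀ n, E n} (hx : UniformlyBounded x)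
    (hy : UniformlyBounded y) : UniformlyBounded (x + y) := by
  obtain ⟨C, hC⟩ := hx
  obtain ⟨D, hD⟩ := hy
  exact ⟨C + D, fun n => (norm_add_le _ _).trans (add_le_add (hC n) (hD n))⟩

theorem UniformlyBounded.smul {x : ∀ n, E n} (c : ℂ) (hx : UniformlyBounded x) :
    UniformlyBounded (c • x) := by
  obtain ⟨C, hC⟩ := hx
  refine ⟨‖c‖ * C, fun n => ?_⟩
  rw [Pi.smul_apply, norm_smul]
  exact mul_le_mul_of_nonneg_left (hC n) (norm_nonneg c)

theorem UniformlyBounded.sub {x y : ∀ n, E n} (hx : UniformlyBounded x)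
    (hy : UniformlyBounded y) : UniformlyBounded (x - y) := by
  obtain ⟨C, hC⟩ := hx
  obtain ⟨D, hD⟩ := hy
  exact ⟨C + D, fun n => (norm_sub_le _ _).trans (add_le_add (hC n) (hD n))⟩

theorem UniformlyBounded.eventually_norm_lt {x : ∀ n, E n} (hx : UniformlyBounded x) {ε : ℝ}
    (h : netSeminorm x < ε) : ∀ᶠ n in atTop, ‖x n‖ < ε :=
  eventually_lt_of_limsup_lt h hx.isBoundedUnder_norm

theorem netSeminorm_le_of_eventually_norm_le {x : ∀ n, E n} {ε : ℝ}
    (h : ∀ᶠ n in atTop, ‖x n‖ ≤ ε) : netSeminorm x ≤ ε :=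
  limsup_le_of_le (isCoboundedUnder_le_of_le atTop (x := 0) fun n => norm_nonneg (x n)) h

namespace IsSoftInductiveSystem

variable {j : ∀ n m : N, E m →L[ℂ] E n}

theorem norm_map_le (hj : IsSoftInductiveSystem j) (n m : N) (ξ : E m) :
    ‖j n m ξ‖ ≤ ‖ξ‖ := by
  by_cases h : m ≤ n
  · exact hj.contraction n m h ξ
  · simp [hj.map_not_le n m h]

theorem uniformlyBounded_basicNet (hj : IsSoftInductiveSystem j) (m : N) (ξ : E m) :
    UniformlyBounded (basicNet j m ξ) :=
  ⟨‖ξ‖, fun n => hj.norm_map_le n m ξ⟩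

theorem jConvergent_iff (hj : IsSoftInductiveSystem j) {x : ∀ n, E n} :
    JConvergent j x ↔ UniformlyBounded x ∧
      ∀ ε : ℝ, 0 < ε → ∃ (m : N) (ξ : E m), ∀ᶠ n in atTop, ‖x n - j n m ξ‖ < ε := by
  refine and_congr_right fun hx => ⟨fun h ε hε => ?_, fun h ε hε => ?_⟩
  · obtain ⟨m, ξ, hξ⟩ := h ε hε
    exact ⟨m, ξ, (hx.sub (hj.uniformlyBounded_basicNet m ξ)).eventually_norm_lt hξ⟩
  · obtain ⟨m, ξ, hξ⟩ := h (ε / 2) (half_pos hε)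
    exact ⟨m, ξ, (netSeminorm_le_of_eventually_norm_le (hξ.mono fun n hn => hn.le)).trans_lt
      (half_lt_self hε)⟩

theorem jConvergent_basicNet (hj : IsSoftInductiveSystem j) (m : N) (ξ : E m) :
    JConvergent j (basicNet j m ξ) :=
  hj.jConvergent_iff.2 ⟨hj.uniformlyBounded_basicNet m ξ, fun ε hε =>
    ⟨m, ξ, Eventually.of_forall fun n => by simpa [basicNet] using hε⟩⟩

/-- Asymptotically, a basic net can be started from any sufficiently late index. -/
theorem eventually_eventually_norm_sub_lt (hj : IsSoftInductiveSystem j) (l : N) (ξ : E l)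
    {ε : ℝ} (hε : 0 < ε) :
    ∀ᶠ m in atTop, ∀ᶠ n in atTop, ‖j n l ξ - j n m (j m l ξ)‖ < ε :=
  ((hj.soft l ξ).eventually_lt_const hε).mono fun m hm =>
    ((hj.uniformlyBounded_basicNet l ξ).sub
      (hj.uniformlyBounded_basicNet m (j m l ξ))).eventually_norm_lt hm

theorem jConvergent_add (hj : IsSoftInductiveSystem j) {x y : ∀ n, E n}
    (hx : JConvergent j x) (hy : JConvergent j y) : JConvergent j (x + y) := by
  rw [hj.jConvergent_iff] at *
  refine ⟨hx.1.add hy.1, fun ε hε => ?_⟩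
  have hε4 : 0 < ε / 4 := by positivity
  obtain ⟨m, ξ, hξ⟩ := hx.2 _ hε4
  obtain ⟨l, η, hη⟩ := hy.2 _ hε4
  obtain ⟨k, hkξ, hkη⟩ := ((hj.eventually_eventually_norm_sub_lt m ξ hε4).and
    (hj.eventually_eventually_norm_sub_lt l η hε4)).exists
  refine ⟨k, j k m ξ + j k l η, ?_⟩
  filter_upwards [hξ, hη, hkξ, hkη] with n h₁ h₂ h₃ h₄
  calc ‖(x + y) n - j n k (j k m ξ + j k l η)‖
      = ‖(x n - j n m ξ) + (y n - j n l η) + (j n m ξ - j n k (j k m ξ))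
          + (j n l η - j n k (j k l η))‖ := by
        rw [Pi.add_apply, map_add]
        congr 1
        abel
    _ ≤ ‖x n - j n m ξ‖ + ‖y n - j n l η‖ + ‖j n m ξ - j n k (j k m ξ)‖
          + ‖j n l η - j n k (j k l η)‖ := norm_add₄_le
    _ < ε := by linarith

theorem jConvergent_smul (hj : IsSoftInductiveSystem j) (c : ℂ) {x : ∀ n, E n}
    (hx : JConvergent j x) : JConvergent j (c • x) := by
  rw [hj.jConvergent_iff] at *
  refine ⟨hx.1.smul c, fun ε hε => ?_⟩
  have hc : 0 < ‖c‖ + 1 := by positivity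
  obtain ⟨m, ξ, hξ⟩ := hx.2 (ε / (‖c‖ + 1)) (by positivity)
  refine ⟨m, c • ξ, hξ.mono fun n hn => ?_⟩
  rw [lt_div_iff₀ hc] at hn
  rw [Pi.smul_apply, map_smul, ← smul_sub, norm_smul]
  nlinarith [norm_nonneg (x n - j n m ξ)]

theorem jConvergent_sub (hj : IsSoftInductiveSystem j) {x y : ∀ n, E n}
    (hx : JConvergent j x) (hy : JConvergent j y) : JConvergent j (x - y) := by
  simpa [sub_eq_add_neg] using hj.jConvergent_add hx (hj.jConvergent_smul (-1) hy)

/-- For uniformly bounded functionals, convergence along all basic nets implies convergence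
along all `j`-convergent nets. -/
theorem exists_tendsto_of_basicNet (hj : IsSoftInductiveSystem j) {φ : ∀ n, E n →L[ℂ] ℂ}
    {C : ℝ} (hφ : ∀ n, ‖φ n‖ ≤ C)
    (h : ∀ (m : N) (ξ : E m), ∃ c : ℂ, Tendsto (fun n => φ n (j n m ξ)) atTop (𝓝 c))
    {x : ∀ n, E n} (hx : JConvergent j x) :
    ∃ c : ℂ, Tendsto (fun n => φ n (x n)) atTop (𝓝 c) := by
  apply cauchy_map_iff_exists_tendsto.1
  rw [Metric.cauchy_iff]
  refine ⟨inferInstance, fun ε hε => ?_⟩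
  have hC : 0 ≤ C := (norm_nonneg _).trans (hφ (Classical.arbitrary N))
  obtain ⟨m, ξ, hξ⟩ := (hj.jConvergent_iff.1 hx).2 (ε / 4 / (C + 1)) (by positivity)
  obtain ⟨c, hc⟩ := h m ξ
  refine ⟨Metric.ball c (ε / 2), ?_, fun z hz w hw => ?_⟩
  · rw [mem_map]
    filter_upwards [hξ, hc (Metric.ball_mem_nhds c (show 0 < ε / 4 by positivity))] with n h₁ h₂
    have h₃ : ‖φ n (x n - j n m ξ)‖ ≤ C * ‖x n - j n m ξ‖ := (φ n).le_of_opNorm_le (hφ n) _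
    rw [lt_div_iff₀ (by positivity)] at h₁
    rw [Set.mem_preimage, Metric.mem_ball, dist_eq_norm] at h₂
    rw [Set.mem_preimage, Metric.mem_ball, dist_eq_norm]
    calc ‖φ n (x n) - c‖ = ‖φ n (x n - j n m ξ) + (φ n (j n m ξ) - c)‖ := by
          rw [map_sub]
          congr 1
          ring
      _ ≤ ‖φ n (x n - j n m ξ)‖ + ‖φ n (j n m ξ) - c‖ := norm_add_le _ _
      _ < ε / 2 := by nlinarith [norm_nonneg (x n - j n m ξ)]
  · have := dist_triangle_right z w c
    rw [Metric.mem_ball] at hz hw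
    linarith

/-- Pointwise limits along basic nets of uniformly bounded functionals are bounded
functionals. -/
theorem exists_continuousLinearMap_tendsto (hj : IsSoftInductiveSystem j)
    {φ : ∀ n, E n →L[ℂ] ℂ} {C : ℝ} (hφ : ∀ n, ‖φ n‖ ≤ C) {m : N}
    (h : ∀ ξ : E m, ∃ c : ℂ, Tendsto (fun n => φ n (j n m ξ)) atTop (𝓝 c)) :
    ∃ ψ : E m →L[ℂ] ℂ, ∀ ξ : E m, Tendsto (fun n => φ n (j n m ξ)) atTop (𝓝 (ψ ξ)) := by
  choose f hf using h
  have hC : 0 ≤ C := (norm_nonneg _).trans (hφ m)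
  refine ⟨LinearMap.mkContinuous
    { toFun := f
      map_add' := fun ξ η => tendsto_nhds_unique (hf (ξ + η))
        (by simpa using (hf ξ).add (hf η))
      map_smul' := fun c ξ => tendsto_nhds_unique (hf (c • ξ))
        (by simpa using (hf ξ).const_mul c) } C fun ξ => ?_, hf⟩
  exact le_of_tendsto' (hf ξ).norm fun n => ((φ n).le_of_opNorm_le (hφ n) _).trans
    (mul_le_mul_of_nonneg_left (hj.norm_map_le n m ξ) hC)

end IsSoftInductiveSystem

theorem norm_le_mul_netSeminorm_of_tendsto {φ : ∀ n, E n →L[ℂ] ℂ} {C : ℝ}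
    (hφ : ∀ n, ‖φ n‖ ≤ C) {x : ∀ n, E n} (hx : UniformlyBounded x) {c : ℂ}
    (hc : Tendsto (fun n => φ n (x n)) atTop (𝓝 c)) : ‖c‖ ≤ C * netSeminorm x := by
  have hC : 0 ≤ C := (norm_nonneg _).trans (hφ (Classical.arbitrary N))
  have key : ∀ r, netSeminorm x < r → ‖c‖ ≤ C * r := fun r hr =>
    le_of_tendsto hc.norm <| (hx.eventually_norm_lt hr).mono fun n hn =>
      ((φ n).le_of_opNorm_le (hφ n) _).trans (mul_le_mul_of_nonneg_left hn.le hC)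
  have hlim : Tendsto (fun r => C * r) (𝓝[>] netSeminorm x) (𝓝 (C * netSeminorm x)) :=
    ((continuous_const.mul continuous_id).tendsto _).mono_left nhdsWithin_le_nhds
  exact ge_of_tendsto hlim (eventually_mem_nhdsWithin.mono key)

namespace IsLimitSpace

variable {j : ∀ n m : N, E m →L[ℂ] E n} {G : Type*} [NormedAddCommGroup G] [NormedSpace ℂ G]
  {L : (∀ n, E n) → G}

theorem map_sub (hL : IsLimitSpace j G L) (hj : IsSoftInductiveSystem j) {x y : ∀ n, E n}
    (hx : JConvergent j x) (hy : JConvergent j y) : L (x - y) = L x - L y := by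
  have h := hL.map_add x ((-1 : ℂ) • y) hx (hj.jConvergent_smul (-1) hy)
  rw [hL.map_smul (-1) y hy] at h
  simpa [sub_eq_add_neg] using h

/-- The limit of `φ n (x n)` depends only on the `j`-limit of `x`. -/
theorem tendsto_unique (hL : IsLimitSpace j G L) (hj : IsSoftInductiveSystem j)
    {φ : ∀ n, E n →L[ℂ] ℂ} {C : ℝ} (hφ : ∀ n, ‖φ n‖ ≤ C) {x y : ∀ n, E n}
    (hx : JConvergent j x) (hy : JConvergent j y) (hxy : L x = L y) {a b : ℂ}
    (ha : Tendsto (fun n => φ n (x n)) atTop (𝓝 a))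
    (hb : Tendsto (fun n => φ n (y n)) atTop (𝓝 b)) : a = b := by
  have hsub := hj.jConvergent_sub hx hy
  have h := norm_le_mul_netSeminorm_of_tendsto hφ hsub.1 (c := a - b)
    (by simpa using ha.sub hb)
  rw [← hL.norm_eq _ hsub, hL.map_sub hj hx hy, hxy, sub_self, norm_zero, mul_zero] at h
  exact sub_eq_zero.1 (norm_le_zero_iff.1 h)

/-- A `j*`-convergent net of functionals induces a bounded functional on the limit space. -/
theorem exists_limit_functional (hL : IsLimitSpace j G L) (hj : IsSoftInductiveSystem j)
    {φ : ∀ n, E n →L[ℂ] ℂ} {C : ℝ} (hφ : ∀ n, ‖φ n‖ ≤ C)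
    (h : ∀ x : ∀ n, E n, JConvergent j x →
      ∃ c : ℂ, Tendsto (fun n => φ n (x n)) atTop (𝓝 c)) :
    ∃ Φ : G →L[ℂ] ℂ, ∀ x : ∀ n, E n, JConvergent j x →
      Tendsto (fun n => φ n (x n)) atTop (𝓝 (Φ (L x))) := by
  choose s hs hLs using hL.surjective
  choose f hf using fun g => h (s g) (hs g)
  have lim : ∀ x, JConvergent j x → Tendsto (fun n => φ n (x n)) atTop (𝓝 (f (L x))) := by
    intro x hx
    obtain ⟨c, hc⟩ := h x hx
    rwa [hL.tendsto_unique hj hφ (hs _) hx (hLs _) (hf (L x)) hc]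
  refine ⟨LinearMap.mkContinuous
    { toFun := f
      map_add' := fun g k => ?_
      map_smul' := fun c g => ?_ } C fun g => ?_, lim⟩
  · refine hL.tendsto_unique hj hφ (hs _) (hj.jConvergent_add (hs g) (hs k)) ?_ (hf _)
      (by simpa using (hf g).add (hf k))
    rw [hL.map_add _ _ (hs g) (hs k), hLs, hLs, hLs]
  · refine hL.tendsto_unique hj hφ (hs _) (hj.jConvergent_smul c (hs g)) ?_ (hf _)
      (by simpa using (hf g).const_mul c)
    rw [hL.map_smul _ _ (hs g), hLs, hLs]
  · have hg := norm_le_mul_netSeminorm_of_tendsto hφ (hs g).1 (hf g)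
    rwa [← hL.norm_eq _ (hs g), hLs] at hg

end IsLimitSpace

/-- A uniformly bounded net `φ` of continuous linear functionals is
`j*`-convergent (i.e. `lim_n φ n (x n)` exists for every `j`-convergent net) iff for
every `m` the net `(φ n ∘ j n m)_n` converges in the weak* topology of `E m →L[ℂ] ℂ`;
and in that case the weak* limit equals `φ_∞ ∘ j_{∞ m}`, where `φ_∞` is the bounded
functional on the limit space determined by `φ_∞ (j-lim x) = lim_n φ n (x n)`. -/
theorem jstar_convergent_iff_weakstar (j : ∀ n m : N, E m →L[ℂ] E n)
    (hj : IsSoftInductiveSystem j)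
    (φ : ∀ n, E n →L[ℂ] ℂ) (hφ : ∃ C : ℝ, ∀ n, ‖φ n‖ ≤ C)
    {G : Type*} [NormedAddCommGroup G] [NormedSpace ℂ G] [CompleteSpace G]
    (L : (∀ n, E n) → G) (hL : IsLimitSpace j G L) :
    ((∀ x : ∀ n, E n, JConvergent j x →
        ∃ c : ℂ, Tendsto (fun n => φ n (x n)) atTop (𝓝 c)) ↔
      (∀ m : N, ∃ ψ : E m →L[ℂ] ℂ, ∀ ξ : E m,
        Tendsto (fun n => φ n (j n m ξ)) atTop (𝓝 (ψ ξ)))) ∧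
    ((∀ x : ∀ n, E n, JConvergent j x →
        ∃ c : ℂ, Tendsto (fun n => φ n (x n)) atTop (𝓝 c)) →
      ∃ Φ : G →L[ℂ] ℂ,
        (∀ x : ∀ n, E n, JConvergent j x →
          Tendsto (fun n => φ n (x n)) atTop (𝓝 (Φ (L x)))) ∧
        ∀ (m : N) (ψ : E m →L[ℂ] ℂ),
          (∀ ξ : E m, Tendsto (fun n => φ n (j n m ξ)) atTop (𝓝 (ψ ξ))) →
          ∀ ξ : E m, ψ ξ = Φ (L (basicNet j m ξ))) := by
  obtain ⟨C, hC⟩ := hφ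
  refine ⟨⟨fun h m => ?_, fun h x hx => ?_⟩, fun h => ?_⟩
  · exact hj.exists_continuousLinearMap_tendsto hC fun ξ => h _ (hj.jConvergent_basicNet m ξ)
  · exact hj.exists_tendsto_of_basicNet hC
      (fun m ξ => (h m).elim fun ψ hψ => ⟨ψ ξ, hψ ξ⟩) hx
  · obtain ⟨Φ, hΦ⟩ := hL.exists_limit_functional hj hC h
    exact ⟨Φ, hΦ, fun m ψ hψ ξ =>
      tendsto_nhds_unique (hψ ξ) (hΦ _ (hj.jConvergent_basicNet m ξ))⟩
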